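/- Let X be a finite nonempty set, σ ∈ Sym(X), and r(x,y) = (y, σ(x)), a bijective non-degenerate solution of the Yang–Baxter equation. Let A = A(X,r) and K a field. Then for each x ∈ X, the element x − σ(x) is normal in K[A] and satisfies (x − σ(x))^{n+1} = (x − σ(x))x^n for all n ≥ 1; hence (x − σ(x))^d = 0 where d is the order of σ. Consequently the ideal P = Σ_{x∈X} K[A](x − σ(x)) is nilpotent, K[A]/P is isomorphic to a polynomial ring K[t_1,…,t_s] where s is the number of disjoint cycles of σ, and P is the unique minimal prime of K[A], equal to both the prime radical and the Jacobson radical of K[A]. -/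

import Mathlib

/-- Defining relations of `A(X,r)` for the permutation solution `r(x,y) = (y, σ(x))`:
`A = ⟨X | xy = y·σ(x)⟩`. -/
def permRel {X : Type*} (σ : Equiv.Perm X) : FreeMonoid X → FreeMonoid X → Prop :=
  fun a b => ∃ x y : X, a = FreeMonoid.of x * FreeMonoid.of y ∧
    b = FreeMonoid.of y * FreeMonoid.of (σ x)

/-- The derived structure monoid of the permutation solution. -/
abbrev PermDerivedMonoid {X : Type*} (σ : Equiv.Perm X) := (conGen (permRel σ)).Quotient

/-- The canonical image of a generator `x ∈ X`. -/
def ofA {X : Type*} (σ : Equiv.Perm X) (x : X) : PermDerivedMonoid σ :=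
  (conGen (permRel σ)).mk' (FreeMonoid.of x)

namespace Stmt14

lemma gen_ind {X : Type*} (σ : Equiv.Perm X) (K : Type*) [Field K]
    {motive : MonoidAlgebra K (PermDerivedMonoid σ) → Prop}
    (gen : ∀ x, motive (MonoidAlgebra.of K (PermDerivedMonoid σ) (ofA σ x)))
    (scal : ∀ r : K, motive (algebraMap K _ r))
    (hadd : ∀ a b, motive a → motive b → motive (a + b))
    (hmul : ∀ a b, motive a → motive b → motive (a * b)) (β) : motive β := by
  induction β using MonoidAlgebra.induction_on with
  | of m =>
    induction m using Con.induction_on with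
    | _ w =>
      induction w using FreeMonoid.inductionOn' with
      | one =>
        have := scal 1
        rw [map_one] at this
        exact this
      | of_mul x w ih =>
        have := hmul _ _ (gen x) ih
        rw [← map_mul] at this
        exact this
  | add x y hx hy => exact hadd _ _ hx hy
  | smul r x hx => rw [Algebra.smul_def]; exact hmul _ _ (scal r) hx

lemma rel {X : Type*} (σ : Equiv.Perm X) (x y : X) :
    ofA σ x * ofA σ y = ofA σ y * ofA σ (σ x) :=
  (Con.eq _).2 (ConGen.Rel.of _ _ ⟨x, y, rfl, rfl⟩)

lemma pow_sup_le {R : Type*} [Ring R] (I L : Ideal R) [L.IsTwoSided] (n : ℕ) :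
    (I ⊔ L) ^ n ≤ I ^ n ⊔ L := by
  induction n with
  | zero => simp [Submodule.pow_zero]
  | succ n ih =>
    rw [Submodule.pow_succ, Submodule.pow_succ]
    refine (Ideal.mul_mono_left ih).trans ?_
    rw [Ideal.mul_sup, Ideal.sup_mul]
    exact sup_le (sup_le le_sup_left (Ideal.mul_le_left.trans le_sup_right))
      (Ideal.mul_le_right.trans le_sup_right)

lemma sup_two {R : Type*} [Ring R] (I L : Ideal R) [I.IsTwoSided] [L.IsTwoSided] :
    (I ⊔ L).IsTwoSided := ⟨fun {a} b ha => by
  obtain ⟨i, hi, l, hl, rfl⟩ := Submodule.mem_sup.1 ha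
  rw [add_mul]
  exact Submodule.add_mem_sup (I.mul_mem_right _ hi) (L.mul_mem_right _ hl)⟩

lemma nil_sup {R : Type*} [Ring R] {ι : Type*} (I : ι → Ideal R) (h2 : ∀ i, (I i).IsTwoSided)
    (h3 : ∀ i, I i ^ 3 = ⊥) (s : Finset ι) :
    (s.sup I).IsTwoSided ∧ ∃ n, (s.sup I) ^ n = ⊥ := by
  classical
  induction s using Finset.induction_on with
  | empty =>
    refine ⟨by rw [Finset.sup_empty]; infer_instance, 1, ?_⟩
    rw [Submodule.pow_one, Finset.sup_empty]
  | insert a s ha ih =>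
    obtain ⟨h, n, hn⟩ := ih
    have := h2 a
    rw [Finset.sup_insert, sup_comm]
    have h' := sup_two (s.sup I) (I a)
    refine ⟨h', n + n + n, ?_⟩
    have key := pow_sup_le (s.sup I) (I a) n
    rw [hn, bot_sup_eq] at key
    rw [Ideal.IsTwoSided.pow_add, Ideal.IsTwoSided.pow_add, eq_bot_iff, ← h3 a,
      show (3 : ℕ) = 1 + 1 + 1 from rfl,
      Ideal.IsTwoSided.pow_add, Ideal.IsTwoSided.pow_add, Submodule.pow_one]
    exact Ideal.mul_mono (Ideal.mul_mono key key) key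

lemma le_jac {R : Type*} [Ring R] (P : Ideal R) (n : ℕ) (hn : P ^ n = ⊥) :
    P ≤ Ideal.jacobson ⊥ := by
  intro p hp
  rw [Ideal.mem_jacobson_iff]
  intro y
  have hq : y * p ∈ P := P.mul_mem_left _ hp
  have hnil : (y * p) ^ n = 0 := by
    have := Ideal.pow_mem_pow hq n
    rwa [hn] at this
  have hN : IsNilpotent (y * p) := ⟨n, hnil⟩
  obtain ⟨v, hv⟩ := hN.isUnit_add_one
  refine ⟨↑v⁻¹, ?_⟩
  have : (↑v⁻¹ : R) * (y * p + 1) = 1 := by rw [← hv]; simp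
  rw [mul_add, mul_one, ← mul_assoc] at this
  rw [this, sub_self]
  exact Ideal.zero_mem _

/-- comparison of a quotient with a polynomial ring, commutative-instance-free -/
lemma exists_lift {K Q : Type*} [Field K] [Ring Q] (hc : ∀ a b : Q, a * b = b * a)
    (i : K →+* Q) {s : ℕ} (v : Fin s → Q) :
    ∃ g : MvPolynomial (Fin s) K →+* Q, (∀ k, g (MvPolynomial.C k) = i k) ∧
      ∀ j, g (MvPolynomial.X j) = v j := by
  let _ : CommRing Q := { ‹Ring Q› with mul_comm := hc }
  exact ⟨MvPolynomial.eval₂Hom i v, fun k => MvPolynomial.eval₂Hom_C _ _ _,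
    fun j => MvPolynomial.eval₂Hom_X' _ _ _⟩

end Stmt14

theorem stmt14 {X : Type*} [Fintype X] [Nonempty X] (σ : Equiv.Perm X)
    (K : Type*) [Field K]
    -- the elements `α_x = x - σ(x)` of `K[A]`
    (α : X → MonoidAlgebra K (PermDerivedMonoid σ))
    (hα : ∀ x : X, α x =
      MonoidAlgebra.of K (PermDerivedMonoid σ) (ofA σ x) -
        MonoidAlgebra.of K (PermDerivedMonoid σ) (ofA σ (σ x)))
    -- `P = Σ_{x ∈ X} K[A]·(x - σ(x))`
    (P : Ideal (MonoidAlgebra K (PermDerivedMonoid σ)))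
    (hPdef : P = Ideal.span {v | ∃ x : X, v = α x})
    -- `s` is the number of disjoint cycles (orbits) of `σ`
    (s : ℕ) (hs : s = Nat.card (Quotient (Equiv.Perm.SameCycle.setoid σ))) :
    -- `x - σ(x)` is normal: `y·(x - σ(x)) = (x - σ(x))·σ(y)` and `K[A]·α = α·K[A]`
    (∀ x y : X,
      MonoidAlgebra.of K (PermDerivedMonoid σ) (ofA σ y) * α x =
        α x * MonoidAlgebra.of K (PermDerivedMonoid σ) (ofA σ (σ y))) ∧
    (∀ x : X, {v | ∃ β, v = β * α x} = {v | ∃ β, v = α x * β}) ∧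
    -- `(x - σ(x))^{n+1} = (x - σ(x))·x^n`
    (∀ x : X, ∀ n : ℕ, 1 ≤ n → α x ^ (n + 1) =
      α x * MonoidAlgebra.of K (PermDerivedMonoid σ) (ofA σ x) ^ n) ∧
    -- `(x - σ(x))^d = 0` for `d` the order of `σ`
    (∀ x : X, α x ^ orderOf σ = 0) ∧
    -- `P` is nilpotent
    (∃ n : ℕ, P ^ n = ⊥) ∧
    -- `K[A]/P ≅ K[t_1, …, t_s]`: there is a surjective ring homomorphism onto the
    -- polynomial ring in `s` variables with kernel exactly `P`
    (∃ f : MonoidAlgebra K (PermDerivedMonoid σ) →+* MvPolynomial (Fin s) K,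
      Function.Surjective f ∧ RingHom.ker f = P) ∧
    -- `P` is the unique minimal prime of `K[A]`, equal to the prime radical and the
    -- Jacobson radical
    P.IsPrime ∧
    (∀ Q : Ideal (MonoidAlgebra K (PermDerivedMonoid σ)), Q.IsPrime → P ≤ Q) ∧
    P = Ideal.jacobson ⊥ := by
  classical
  set u : X → MonoidAlgebra K (PermDerivedMonoid σ) :=
    fun x => MonoidAlgebra.of K (PermDerivedMonoid σ) (ofA σ x) with hu
  have hα' : ∀ x, α x = u x - u (σ x) := hα
  have hr : ∀ x y, u x * u y = u y * u (σ x) := fun x y => by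
    simp only [hu, ← map_mul, Stmt14.rel σ x y]
  have h1 : ∀ x y, u y * α x = α x * u (σ y) := fun x y => by
    rw [hα', mul_sub, sub_mul, hr y x, hr y (σ x)]
  have hR : ∀ x β, ∃ γ, β * α x = α x * γ := fun x β => by
    induction β using Stmt14.gen_ind σ K with
    | gen y => exact ⟨_, h1 x y⟩
    | scal r => exact ⟨_, Algebra.commutes r _⟩
    | hadd a b ha hb =>
      obtain ⟨c, hc⟩ := ha
      obtain ⟨d, hd⟩ := hb
      exact ⟨c + d, by rw [add_mul, mul_add, hc, hd]⟩
    | hmul a b ha hb =>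
      obtain ⟨c, hc⟩ := ha
      obtain ⟨d, hd⟩ := hb
      exact ⟨c * d, by rw [mul_assoc, hd, ← mul_assoc, hc, mul_assoc]⟩
  have hL : ∀ x β, ∃ γ, α x * β = γ * α x := fun x β => by
    induction β using Stmt14.gen_ind σ K with
    | gen y => exact ⟨u (σ.symm y), by rw [h1, Equiv.apply_symm_apply]⟩
    | scal r => exact ⟨_, (Algebra.commutes r _).symm⟩
    | hadd a b ha hb =>
      obtain ⟨c, hc⟩ := ha
      obtain ⟨d, hd⟩ := hb
      exact ⟨c + d, by rw [add_mul, mul_add, hc, hd]⟩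
    | hmul a b ha hb =>
      obtain ⟨c, hc⟩ := ha
      obtain ⟨d, hd⟩ := hb
      exact ⟨c * d, by rw [← mul_assoc, hc, mul_assoc, hd, mul_assoc]⟩
  have hz : ∀ x, u x * α x = 0 := fun x => by
    rw [hα', mul_sub, hr x x, sub_self]
  have hz' : ∀ x, α x * u (σ x) = 0 := fun x => by rw [← h1, hz]
  have hsq : ∀ x, α x * α x = α x * u x := fun x => by
    conv_lhs => rw [hα' x, mul_sub, ← hα' x, hz', sub_zero]
  have h3 : ∀ x, ∀ n : ℕ, α x ^ (n + 1) = α x * u x ^ n := fun x n => by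
    induction n with
    | zero => simp
    | succ n ih => rw [pow_succ', ih, ← mul_assoc, hsq, mul_assoc, ← pow_succ']
  have hcube : ∀ x, α x ^ 3 = 0 := fun x => by
    obtain ⟨z, rfl⟩ := σ.surjective x
    rw [h3, pow_two, ← mul_assoc, ← h1, mul_assoc, ← h1, ← mul_assoc, hr z z, mul_assoc, hz,
      mul_zero]
  have hd : ∀ x, α x ^ orderOf σ = 0 := fun x => by
    have hpos : 0 < orderOf σ := orderOf_pos σ
    have hp := pow_orderOf_eq_one σ
    rcases Nat.lt_or_ge (orderOf σ) 3 with h | h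
    · obtain h | h : orderOf σ = 1 ∨ orderOf σ = 2 := by omega
      · rw [h, pow_one] at hp ⊢
        have hx : σ x = x := by
          have := DFunLike.congr_fun hp x
          simpa using this
        rw [hα', hx, sub_self]
      · rw [h] at hp ⊢
        have h2 : σ (σ x) = x := by
          have := DFunLike.congr_fun hp x
          simpa [pow_two] using this
        rw [pow_two, hsq, hα', sub_mul, hr (σ x) x, h2, sub_self]
    · obtain ⟨k, hk⟩ := Nat.exists_eq_add_of_le h
      rw [hk, pow_add, hcube, zero_mul]
  have h2s : ∀ x, (Ideal.span {α x}).IsTwoSided := fun x => ⟨fun {a} b ha => by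
    obtain ⟨c, rfl⟩ := Ideal.mem_span_singleton'.1 ha
    obtain ⟨e, he⟩ := hL x b
    rw [mul_assoc, he, ← mul_assoc]
    exact Ideal.mul_mem_left _ _ (Ideal.subset_span rfl)⟩
  have hPs : P = Finset.univ.sup (fun x => Ideal.span {α x}) := by
    apply le_antisymm
    · rw [hPdef, Ideal.span_le]
      rintro _ ⟨x, rfl⟩
      exact (Finset.le_sup (f := fun x => Ideal.span {α x}) (Finset.mem_univ x))
        (Ideal.subset_span rfl)
    · refine Finset.sup_le fun x _ => ?_
      rw [hPdef]
      exact Ideal.span_mono (by rintro _ rfl; exact ⟨x, rfl⟩)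
  obtain ⟨hP2, N, hN⟩ := Stmt14.nil_sup (fun x => Ideal.span {α x}) h2s
    (fun x => by
      have := h2s x
      rw [Ideal.span_singleton_pow, hcube]; simp) Finset.univ
  rw [← hPs] at hP2 hN
  have hαP : ∀ x, α x ∈ P := fun x => by rw [hPdef]; exact Ideal.subset_span ⟨x, rfl⟩
  have hiso : ∃ f : MonoidAlgebra K (PermDerivedMonoid σ) →+* MvPolynomial (Fin s) K,
      Function.Surjective f ∧ RingHom.ker f = P := by
    obtain ⟨e⟩ : Nonempty (Quotient (Equiv.Perm.SameCycle.setoid σ) ≃ Fin s) := by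
      rw [hs]; exact ⟨Finite.equivFin _⟩
    let q : X → Fin s := fun x => e (Quotient.mk _ x)
    have hqσ : ∀ x, q (σ x) = q x := fun x => by
      refine congrArg e (Quotient.sound ?_)
      exact (Equiv.Perm.SameCycle.refl σ x).apply_left
    let F : PermDerivedMonoid σ →* MvPolynomial (Fin s) K :=
      (conGen (permRel σ)).lift (FreeMonoid.lift fun x => MvPolynomial.X (q x)) (by
        refine Con.conGen_le.2 ?_
        rintro _ _ ⟨x, y, rfl, rfl⟩
        simp [Con.ker_rel, hqσ, mul_comm])
    let f := MonoidAlgebra.lift K (MvPolynomial (Fin s) K) (PermDerivedMonoid σ) F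
    have hf : ∀ x, f (u x) = MvPolynomial.X (q x) := fun x => by
      simp only [f, hu]
      rw [MonoidAlgebra.lift_of]
      simp [F, ofA]
    have hσ : ∀ x y, σ.SameCycle x y → Ideal.Quotient.mk P (u x) = Ideal.Quotient.mk P (u y) := by
      have h0 : ∀ x, Ideal.Quotient.mk P (u (σ x)) = Ideal.Quotient.mk P (u x) := fun x => by
        rw [eq_comm, Ideal.Quotient.eq, ← hα']; exact hαP x
      have hn : ∀ (n : ℕ) x, Ideal.Quotient.mk P (u ((σ ^ n) x)) = Ideal.Quotient.mk P (u x) := by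
        intro n
        induction n with
        | zero => intro x; simp
        | succ n ih => intro x; rw [pow_succ', Equiv.Perm.mul_apply, h0, ih]
      intro x y hxy
      obtain ⟨n, rfl⟩ := hxy.exists_nat_pow_eq
      rw [hn]
    have hcomm : ∀ a b : MonoidAlgebra K (PermDerivedMonoid σ) ⧸ P, a * b = b * a := by
      intro a b
      obtain ⟨a, rfl⟩ := Ideal.Quotient.mk_surjective a
      obtain ⟨b, rfl⟩ := Ideal.Quotient.mk_surjective b
      change Commute _ _
      induction a using Stmt14.gen_ind σ K with
      | gen x =>
        induction b using Stmt14.gen_ind σ K with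
        | gen y =>
          change Ideal.Quotient.mk P (u x) * Ideal.Quotient.mk P (u y) =
            Ideal.Quotient.mk P (u y) * Ideal.Quotient.mk P (u x)
          have e1 := congrArg (Ideal.Quotient.mk P) (hr x y)
          have e2 := hσ x (σ x) (Equiv.Perm.SameCycle.refl σ x).apply_right
          calc _ = Ideal.Quotient.mk P (u x * u y) := (RingHom.map_mul _ _ _).symm
            _ = _ := e1.trans (RingHom.map_mul _ _ _)
            _ = _ := by rw [← e2]
        | scal r => exact Commute.map (Algebra.commutes r _).symm (Ideal.Quotient.mk P)
        | hadd a b ha hb => rw [map_add]; exact ha.add_right hb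
        | hmul a b ha hb => rw [map_mul]; exact ha.mul_right hb
      | scal r => exact Commute.map (Algebra.commutes r _) (Ideal.Quotient.mk P)
      | hadd a b ha hb => rw [map_add]; exact ha.add_left hb
      | hmul a b ha hb => rw [map_mul]; exact ha.mul_left hb
    obtain ⟨g, hgC, hgX⟩ := Stmt14.exists_lift hcomm
      ((Ideal.Quotient.mk P).comp (algebraMap K _))
      (fun j => Ideal.Quotient.mk P (u (e.symm j).out))
    have hgf : ∀ β, g (f β) = Ideal.Quotient.mk P β := by
      intro β
      induction β using Stmt14.gen_ind σ K with
      | gen x =>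
        change g (f (u x)) = Ideal.Quotient.mk P (u x)
        rw [hf, hgX]
        apply hσ
        simp only [q, Equiv.symm_apply_apply]
        exact Quotient.mk_out (s := Equiv.Perm.SameCycle.setoid σ) x
      | scal r => rw [AlgHom.commutes, MvPolynomial.algebraMap_eq, hgC]; rfl
      | hadd a b ha hb => simp only [map_add, ha, hb]
      | hmul a b ha hb => simp only [map_mul, ha, hb]
    refine ⟨f.toRingHom, ?_, ?_⟩
    · intro p
      induction p using MvPolynomial.induction_on with
      | C a => exact ⟨algebraMap K _ a, f.commutes a⟩
      | add p q hp hq =>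
        obtain ⟨a, rfl⟩ := hp
        obtain ⟨b, rfl⟩ := hq
        exact ⟨a + b, map_add _ _ _⟩
      | mul_X p i hp =>
        obtain ⟨a, rfl⟩ := hp
        refine ⟨a * u (e.symm i).out, ?_⟩
        rw [map_mul]
        congr 1
        refine (hf _).trans ?_
        simp [q]
    · apply le_antisymm
      · intro β hβ
        have hβ' : f β = 0 := hβ
        rw [← Ideal.Quotient.eq_zero_iff_mem, ← hgf, hβ', map_zero]
      · rw [hPdef, Ideal.span_le]
        rintro _ ⟨x, rfl⟩
        change f (α x) = 0
        rw [hα', map_sub, hf, hf, hqσ, sub_self]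
  refine ⟨h1, ?_, fun x n _ => h3 x n, hd, ⟨N, hN⟩, hiso, ?_⟩
  · intro x
    ext v
    constructor
    · rintro ⟨β, rfl⟩
      exact hR x β
    · rintro ⟨β, rfl⟩
      exact hL x β
  obtain ⟨f, hfs, hfk⟩ := hiso
  have hprime : P.IsPrime := hfk ▸ RingHom.ker_isPrime f
  refine ⟨hprime, ?_, ?_⟩
  · intro Q hQ
    rw [hPdef, Ideal.span_le]
    rintro _ ⟨x, rfl⟩
    have h0 : α x * (α x * α x) ∈ Q := by
      have := hcube x
      rw [pow_succ', pow_two] at this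
      rw [this]; exact Q.zero_mem
    rcases hQ.mem_or_mem' h0 with h | h
    · exact h
    · rcases hQ.mem_or_mem' h with h | h <;> exact h
  · apply le_antisymm (Stmt14.le_jac P N hN)
    have hj : (⊥ : Ideal (MvPolynomial (Fin s) K)).jacobson = ⊥ :=
      IsJacobsonRing.out inferInstance (Ideal.isPrime_bot).isRadical
    calc Ideal.jacobson ⊥ ≤ P.jacobson := Ideal.jacobson_mono bot_le
      _ = P := by
        rw [← hfk, RingHom.ker_eq_comap_bot, ← Ideal.comap_jacobson_of_surjective hfs, hj]
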